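/- For every n ≥ 0, a_{2n} = 4·∫_1^∞ (d/dx)[x^{3/2}·ψ′(x)] · ((1/2)·log x)^{2n}/(2n)! · x^{−1/4} dx, where ψ(x) = Σ_{m=1}^∞ e^{−m²·π·x} and ψ′ denotes its derivative. -/

import Mathlib

/-- The Riemann xi function: `ξ(s) = (1/2)·s·(s−1)·π^{−s/2}·Γ(s/2)·ζ(s)`. -/
noncomputable def riemannXi (s : ℂ) : ℂ := (1 / 2) * s * (s - 1) * completedRiemannZeta s

/-- The `2n`-th Taylor coefficient of `ξ` at `s = 1/2`, a real number. -/
noncomputable def a (n : ℕ) : ℝ :=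
  (iteratedDeriv (2 * n) riemannXi (1 / 2)).re / (2 * n).factorial

/-- `ψ(x) = Σ_{m=1}^∞ e^{−m²πx}`. -/
noncomputable def psi (x : ℝ) : ℝ :=
  ∑' m : ℕ, Real.exp (-((m : ℝ) + 1) ^ 2 * Real.pi * x)

open Set Filter Topology MeasureTheory Asymptotics Complex HurwitzZeta

/-- The moment sums `∑ m ^ (2k) * exp (-m² π x)` over `m ≥ 1`. -/
noncomputable def thetaMoment (k : ℕ) (x : ℝ) : ℝ :=
  ∑' m : ℕ, ((m : ℝ) + 1) ^ (2 * k) * Real.exp (-((m : ℝ) + 1) ^ 2 * Real.pi * x)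

/-- The derivative of `x ^ (3 / 2) * ψ'(x)`, as a combination of moment sums. -/
noncomputable def xiKernel (x : ℝ) : ℝ :=
  Real.pi ^ 2 * (x ^ (3 / 2 : ℝ) * thetaMoment 2 x) -
    3 / 2 * Real.pi * (x ^ (1 / 2 : ℝ) * thetaMoment 1 x)

lemma thetaMoment_zero : thetaMoment 0 = psi := by
  ext x
  simp [thetaMoment, psi]

lemma summable_thetaMoment (k : ℕ) {x : ℝ} (hx : 0 < x) :
    Summable fun m : ℕ ↦
      ((m : ℝ) + 1) ^ (2 * k) * Real.exp (-((m : ℝ) + 1) ^ 2 * Real.pi * x) := by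
  refine (HurwitzKernelBounds.summable_f_nat (2 * k) 1 hx).congr fun m ↦ ?_
  rw [HurwitzKernelBounds.f_nat]
  ring_nf

lemma hasDerivAt_thetaMoment (k : ℕ) {x : ℝ} (hx : 0 < x) :
    HasDerivAt (thetaMoment k) (-Real.pi * thetaMoment (k + 1) x) x := by
  have hc : 0 < x / 2 := by positivity
  have h := hasDerivAt_tsum_of_isPreconnected
    (g := fun (m : ℕ) (y : ℝ) ↦
      ((m : ℝ) + 1) ^ (2 * k) * Real.exp (-((m : ℝ) + 1) ^ 2 * Real.pi * y))
    (g' := fun (m : ℕ) (y : ℝ) ↦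
      -Real.pi * (((m : ℝ) + 1) ^ (2 * (k + 1)) * Real.exp (-((m : ℝ) + 1) ^ 2 * Real.pi * y)))
    (t := Ioi (x / 2)) (y₀ := x) (y := x)
    ((summable_thetaMoment (k + 1) hc).mul_left Real.pi) isOpen_Ioi isPreconnected_Ioi
    (fun m y _ ↦ ?_) (fun m y hy ↦ ?_) (half_lt_self hx) (summable_thetaMoment k hx)
    (half_lt_self hx)
  · rwa [tsum_mul_left] at h
  · convert! (((hasDerivAt_id y).const_mul (-((m : ℝ) + 1) ^ 2 * Real.pi)).exp).const_mul
      (((m : ℝ) + 1) ^ (2 * k)) using 1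
    simp only [id]
    ring
  · have hy' : x / 2 ≤ y := le_of_lt hy
    rw [norm_mul, norm_neg, Real.norm_of_nonneg Real.pi_pos.le, Real.norm_of_nonneg (by positivity)]
    simp only [neg_mul]
    gcongr

lemma thetaMoment_nonneg (k : ℕ) (x : ℝ) : 0 ≤ thetaMoment k x :=
  tsum_nonneg fun _ ↦ by positivity

lemma thetaMoment_le (k : ℕ) {x : ℝ} (hx : 1 ≤ x) :
    thetaMoment k x ≤ Real.exp Real.pi * thetaMoment k 1 * Real.exp (-Real.pi * x) := by
  have h1 := (summable_thetaMoment k one_pos).mul_left (Real.exp (Real.pi - Real.pi * x))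
  calc thetaMoment k x
      ≤ Real.exp (Real.pi - Real.pi * x) * thetaMoment k 1 := by
        rw [thetaMoment, thetaMoment, ← tsum_mul_left]
        refine (summable_thetaMoment k (by positivity)).tsum_le_tsum (fun m ↦ ?_) h1
        rw [mul_left_comm, ← Real.exp_add]
        gcongr
        have : (1 : ℝ) ≤ ((m : ℝ) + 1) ^ 2 := one_le_pow₀ (by simp)
        have := mul_nonneg (mul_nonneg (sub_nonneg.2 this) Real.pi_pos.le) (sub_nonneg.2 hx)
        linarith
    _ = _ := by
        rw [mul_right_comm, ← Real.exp_add, neg_mul, sub_eq_add_neg]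

lemma isBigO_atTop_rpow_mul_thetaMoment (k : ℕ) (p r : ℝ) :
    (fun x ↦ x ^ p * thetaMoment k x) =O[atTop] (fun x : ℝ ↦ x ^ r) := by
  have h1 : thetaMoment k =O[atTop] fun x ↦ Real.exp (-Real.pi * x) := by
    refine .of_bound (Real.exp Real.pi * thetaMoment k 1) ?_
    filter_upwards [eventually_ge_atTop 1] with x hx
    rw [Real.norm_of_nonneg (thetaMoment_nonneg k x), Real.norm_of_nonneg (Real.exp_pos _).le]
    exact thetaMoment_le k hx
  have h2 := h1.trans (isLittleO_exp_neg_mul_rpow_atTop Real.pi_pos (r - p)).isBigO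
  refine ((isBigO_refl (fun x : ℝ ↦ x ^ p) atTop).mul h2).congr' .rfl ?_
  filter_upwards [eventually_gt_atTop 0] with x hx
  rw [← Real.rpow_add hx, add_sub_cancel]

lemma hasDerivAt_psi {x : ℝ} (hx : 0 < x) :
    HasDerivAt psi (-Real.pi * thetaMoment 1 x) x := by
  rw [← thetaMoment_zero]
  exact hasDerivAt_thetaMoment 0 hx

lemma hasDerivAt_rpow_mul_deriv_psi {x : ℝ} (hx : 0 < x) :
    HasDerivAt (fun y : ℝ ↦ y ^ ((3 : ℝ) / 2) * deriv psi y) (xiKernel x) x := by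
  have h : HasDerivAt (fun y : ℝ ↦ y ^ ((3 : ℝ) / 2) * (-Real.pi * thetaMoment 1 y))
      (xiKernel x) x := by
    convert! (Real.hasDerivAt_rpow_const (p := 3 / 2) (Or.inl hx.ne')).mul
      ((hasDerivAt_thetaMoment 1 hx).const_mul (-Real.pi)) using 1
    rw [xiKernel]
    norm_num
    ring
  refine h.congr_of_eventuallyEq ?_
  filter_upwards [eventually_gt_nhds hx] with y hy
  rw [(hasDerivAt_psi hy).deriv]

lemma continuousOn_xiKernel : ContinuousOn xiKernel (Ioi 0) := fun x hx ↦ by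
  have hx : 0 < x := hx
  have h (p : ℝ) (k : ℕ) : ContinuousAt (fun y : ℝ ↦ y ^ p * thetaMoment k y) x :=
    (Real.continuousAt_rpow_const _ _ (Or.inl hx.ne')).mul
      (hasDerivAt_thetaMoment k hx).continuousAt
  exact (((h _ 2).const_mul _).sub ((h _ 1).const_mul _)).continuousWithinAt

lemma isBigO_atTop_xiKernel (r : ℝ) : xiKernel =O[atTop] (fun x : ℝ ↦ x ^ r) :=
  ((isBigO_atTop_rpow_mul_thetaMoment 2 _ r).const_mul_left _).sub
    ((isBigO_atTop_rpow_mul_thetaMoment 1 _ r).const_mul_left _)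

lemma psi_functional_equation {x : ℝ} (hx : 0 < x) :
    psi x = x ^ (-1 / 2 : ℝ) * psi x⁻¹ + (1 / 2) * x ^ (-1 / 2 : ℝ) - 1 / 2 := by
  have h {t : ℝ} (ht : 0 < t) : 2 * psi t = cosKernel 0 t - 1 := by
    rw [psi, ← tsum_mul_left]
    refine HasSum.tsum_eq ?_
    convert! hasSum_nat_cosKernel₀ 0 ht using 2 with m
    simp only [mul_zero, zero_mul, Real.cos_zero, mul_one]
    ring_nf
  have h1 := h hx
  have h2 := h (inv_pos.2 hx)
  have h3 := evenKernel_functional_equation 0 x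
  rw [evenKernel_eq_cosKernel_of_zero, show 1 / x ^ (1 / 2 : ℝ) = x ^ (-1 / 2 : ℝ) by
    rw [neg_div, Real.rpow_neg hx.le, one_div (x ^ _)], one_div] at h3
  have h4 : cosKernel 0 x⁻¹ = 2 * psi x⁻¹ + 1 := by linarith
  rw [h4] at h3
  linarith

lemma xiKernel_inv {x : ℝ} (hx : 0 < x) : xiKernel x⁻¹ = x ^ (3 / 2 : ℝ) * xiKernel x := by
  have hinv {y : ℝ} (hy : 0 < y) {k : ℕ} : HasDerivAt (fun t ↦ thetaMoment k t⁻¹)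
      (Real.pi * thetaMoment (k + 1) y⁻¹ * y ^ (-2 : ℝ)) y := by
    convert! (hasDerivAt_thetaMoment k (inv_pos.2 hy)).comp y (hasDerivAt_inv hy.ne') using 1
    rw [Real.rpow_neg hy.le, Real.rpow_two]
    ring
  have hpsi {y : ℝ} (hy : 0 < y) : y ^ (3 / 2 : ℝ) * deriv psi y =
      -(1 / 2) * psi y⁻¹ + Real.pi * (y ^ (-1 : ℝ) * thetaMoment 1 y⁻¹) - 1 / 4 := by
    have hp := Real.hasDerivAt_rpow_const (x := y) (p := -1 / 2) (Or.inl hy.ne')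
    have hd := (((hp.mul (hinv hy (k := 0))).add (hp.const_mul (1 / 2))).sub_const (1 / 2))
    have he : HasDerivAt psi _ y := hd.congr_of_eventuallyEq (by
      filter_upwards [eventually_gt_nhds hy] with z hz
      rw [psi_functional_equation hz, thetaMoment_zero]
      rfl)
    have e1 : y ^ (3 / 2 : ℝ) * y ^ (-1 / 2 - 1 : ℝ) = 1 := by
      rw [← Real.rpow_add hy]; norm_num
    have e2 : y ^ (3 / 2 : ℝ) * (y ^ (-1 / 2 : ℝ) * y ^ (-2 : ℝ)) = y ^ (-1 : ℝ) := by
      rw [← Real.rpow_add hy, ← Real.rpow_add hy]; norm_num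
    rw [he.deriv, thetaMoment_zero, ← e2]
    linear_combination (-1 / 2 * psi y⁻¹ - 1 / 4) * e1
  have hd : HasDerivAt (fun y : ℝ ↦ y ^ ((3 : ℝ) / 2) * deriv psi y) _ x :=
    ((((hinv hx (k := 0)).const_mul (-(1 / 2))).add
      (((Real.hasDerivAt_rpow_const (p := -1) (Or.inl hx.ne')).mul
        (hinv hx (k := 1))).const_mul Real.pi)).sub_const (1 / 4)).congr_of_eventuallyEq (by
      filter_upwards [eventually_gt_nhds hx] with z hz
      rw [hpsi hz, thetaMoment_zero]
      rfl)
  rw [(hasDerivAt_rpow_mul_deriv_psi hx).unique hd, xiKernel, Real.inv_rpow hx.le,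
    Real.inv_rpow hx.le, ← Real.rpow_neg hx.le, ← Real.rpow_neg hx.le]
  have e1 : x ^ (3 / 2 : ℝ) * x ^ (-2 : ℝ) = x ^ (-(1 / 2) : ℝ) := by
    rw [← Real.rpow_add hx]; norm_num
  have e2 : x ^ (3 / 2 : ℝ) * (x ^ (-1 : ℝ) * x ^ (-2 : ℝ)) = x ^ (-(3 / 2) : ℝ) := by
    rw [← Real.rpow_add hx, ← Real.rpow_add hx]; norm_num
  rw [← e1, ← e2]
  norm_num
  ring

lemma isBigO_zero_xiKernel (r : ℝ) : xiKernel =O[𝓝[>] 0] (fun x : ℝ ↦ x ^ r) := by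
  have h := (isBigO_refl (fun x : ℝ ↦ x ^ (-(3 / 2) : ℝ)) (𝓝[>] 0)).mul
    ((isBigO_atTop_xiKernel (-(r + 3 / 2))).comp_tendsto tendsto_inv_nhdsGT_zero)
  refine h.congr' ?_ ?_
  · filter_upwards [self_mem_nhdsWithin] with x (hx : 0 < x)
    rw [Function.comp_apply, xiKernel_inv hx, ← mul_assoc, ← Real.rpow_add hx]
    norm_num
  · filter_upwards [self_mem_nhdsWithin] with x (hx : 0 < x)
    rw [Function.comp_apply, Real.inv_rpow hx.le, ← Real.rpow_neg hx.le, ← Real.rpow_add hx]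
    norm_num

lemma mellin_thetaMoment (k : ℕ) {s : ℂ} (hs : 1 < s.re) :
    mellin (fun t ↦ (thetaMoment k t : ℂ)) (s / 2 + k) =
      (Real.pi : ℂ) ^ (-(s / 2 + k)) * Complex.Gamma (s / 2 + k) * riemannZeta s := by
  have hre : (s / 2 + k).re = s.re / 2 + k := by simp
  have hpow (m : ℕ) : ((((m : ℝ) + 1) ^ 2 : ℝ) : ℂ) ^ (s / 2 + k) =
      ((m : ℂ) + 1) ^ s * ((m : ℂ) + 1) ^ (2 * k) := by
    have h0 : ((m : ℂ) + 1) ≠ 0 := Nat.cast_add_one_ne_zero m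
    have h1 : (0 : ℝ) ≤ (m : ℝ) + 1 := by positivity
    have : ((((m : ℝ) + 1) ^ 2 : ℝ) : ℂ) ^ (s / 2 + k) = ((m : ℂ) + 1) ^ (s + (2 * k : ℕ)) := by
      rw [sq, ofReal_mul, mul_cpow_ofReal_nonneg h1 h1, ← cpow_add _ _ (by exact_mod_cast h0)]
      push_cast
      ring_nf
    rw [this, cpow_add _ _ h0, cpow_natCast]
  have h := hasSum_mellin_pi_mul (a := fun m : ℕ ↦ ((m : ℂ) + 1) ^ (2 * k))
    (q := fun m : ℕ ↦ ((m : ℝ) + 1) ^ 2) (F := fun t ↦ (thetaMoment k t : ℂ)) (s := s / 2 + k)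
    (fun m ↦ Or.inr (by positivity)) (by rw [hre]; positivity) (fun t ht ↦ ?_) ?_
  · rw [← h.tsum_eq, zeta_eq_tsum_one_div_nat_add_one_cpow hs, ← tsum_mul_left]
    congr with m
    have h0 : ((m : ℂ) + 1) ≠ 0 := Nat.cast_add_one_ne_zero m
    rw [hpow, mul_one_div, mul_div_assoc, mul_comm (_ ^ s),
      div_mul_cancel_left₀ (pow_ne_zero _ h0), ← div_eq_mul_inv]
  · have := (summable_thetaMoment k ht).hasSum
    rw [← hasSum_ofReal] at this
    convert! this using 2 with m
    push_cast
    ring_nf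
  · refine ((Complex.summable_one_div_nat_cpow.mpr hs).norm.comp_injective
      (add_left_injective 1)).congr fun m ↦ ?_
    have h0 : ((m : ℂ) + 1) ≠ 0 := Nat.cast_add_one_ne_zero m
    have := congrArg norm (hpow m)
    rw [norm_cpow_eq_rpow_re_of_pos (by positivity)] at this
    rw [this, norm_mul, div_mul_cancel_right₀ (by simp [h0])]
    simp

lemma mellinConvergent_thetaMoment (k : ℕ) {s : ℂ} (hs : 1 < s.re) :
    MellinConvergent (fun t ↦ (thetaMoment k t : ℂ)) (s / 2 + k) := by
  by_contra h
  have h1 := integral_undef h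
  rw [← mellin, mellin_thetaMoment k hs] at h1
  refine mul_ne_zero (mul_ne_zero ?_ ?_) (riemannZeta_ne_zero_of_one_lt_re hs) h1
  · simp [cpow_eq_zero_iff, Real.pi_ne_zero]
  · refine Gamma_ne_zero_of_re_pos ?_
    rw [show (s / 2 + k).re = s.re / 2 + k by simp]
    positivity

lemma mellin_xiKernel_of_one_lt_re {s : ℂ} (hs : 1 < s.re) :
    2 * mellin (fun t ↦ (xiKernel t : ℂ)) (s / 2 + 1 / 2) = riemannXi s := by
  have hconv (k : ℕ) := mellinConvergent_thetaMoment k hs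
  have h2 : s / 2 + 1 / 2 + 3 / 2 = s / 2 + (2 : ℕ) := by push_cast; ring
  have h1 : s / 2 + 1 / 2 + 1 / 2 = s / 2 + (1 : ℕ) := by push_cast; ring
  have hA : MellinConvergent (fun t : ℝ ↦ (t : ℂ) ^ (3 / 2 : ℂ) • (thetaMoment 2 t : ℂ))
      (s / 2 + 1 / 2) := by
    rw [MellinConvergent.cpow_smul, h2]; exact hconv 2
  have hB : MellinConvergent (fun t : ℝ ↦ (t : ℂ) ^ (1 / 2 : ℂ) • (thetaMoment 1 t : ℂ))
      (s / 2 + 1 / 2) := by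
    rw [MellinConvergent.cpow_smul, h1]; exact hconv 1
  have h := (hasMellin_sub (hA.const_smul ((Real.pi : ℂ) ^ 2))
    (hB.const_smul (3 / 2 * (Real.pi : ℂ)))).2
  rw [mellin_const_smul, mellin_const_smul, mellin_cpow_smul, mellin_cpow_smul, h1, h2,
    mellin_thetaMoment _ hs, mellin_thetaMoment _ hs] at h
  have hK : mellin (fun t ↦ (xiKernel t : ℂ)) (s / 2 + 1 / 2) = mellin (fun t : ℝ ↦
      (Real.pi : ℂ) ^ 2 • (t : ℂ) ^ (3 / 2 : ℂ) • (thetaMoment 2 t : ℂ) -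
      (3 / 2 * (Real.pi : ℂ)) • (t : ℂ) ^ (1 / 2 : ℂ) • (thetaMoment 1 t : ℂ))
      (s / 2 + 1 / 2) := by
    refine setIntegral_congr_fun measurableSet_Ioi fun t (ht : 0 < t) ↦ ?_
    simp only [xiKernel, smul_eq_mul, ofReal_sub, ofReal_mul, ofReal_cpow ht.le]
    push_cast
    rfl
  have hs0 : s ≠ 0 := ne_zero_of_one_lt_re hs
  have hπ : (Real.pi : ℂ) ≠ 0 := ofReal_ne_zero.2 Real.pi_ne_zero
  have hs2 : s / 2 + 1 ≠ 0 := fun h0 ↦ by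
    have := congrArg re h0
    simp at this
    linarith
  rw [hK, h, riemannXi, completedZeta_eq_tsum_of_one_lt_re hs, ← zeta_eq_tsum_one_div_nat_cpow hs]
  have g1 : Complex.Gamma (s / 2 + (1 : ℕ)) = s / 2 * Complex.Gamma (s / 2) := by
    rw [Nat.cast_one, Gamma_add_one _ (div_ne_zero hs0 two_ne_zero)]
  have g2 : Complex.Gamma (s / 2 + (2 : ℕ)) =
      (s / 2 + 1) * (s / 2 * Complex.Gamma (s / 2)) := by
    rw [← g1, Nat.cast_one, ← Gamma_add_one _ hs2]
    congr 1
    push_cast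
    ring
  have p (k : ℕ) : (Real.pi : ℂ) ^ k * (Real.pi : ℂ) ^ (-(s / 2 + k)) =
      (Real.pi : ℂ) ^ (-s / 2) := by
    rw [← cpow_natCast, ← cpow_add _ _ hπ]
    ring_nf
  have p1 := p 1
  have p2 := p 2
  rw [g1, g2, smul_eq_mul, smul_eq_mul]
  linear_combination (2 * (s / 2 + 1) * (s / 2 * Complex.Gamma (s / 2)) * riemannZeta s) * p2 -
    (3 * (s / 2 * Complex.Gamma (s / 2)) * riemannZeta s) * p1

/-- If `f` is rapidly decaying at `0` and `∞`, so is `c * log • f`. -/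
lemma isBigO_rpow_log_smul {f : ℝ → ℂ} (hfc : LocallyIntegrableOn f (Ioi 0))
    (htop : ∀ r : ℝ, f =O[atTop] (fun x : ℝ ↦ x ^ r))
    (hbot : ∀ r : ℝ, f =O[𝓝[>] 0] (fun x : ℝ ↦ x ^ r)) (c : ℝ) :
    LocallyIntegrableOn (fun t ↦ (c * Real.log t) • f t) (Ioi 0) ∧
      (∀ r : ℝ, (fun t ↦ (c * Real.log t) • f t) =O[atTop] (fun x : ℝ ↦ x ^ r)) ∧
      ∀ r : ℝ, (fun t ↦ (c * Real.log t) • f t) =O[𝓝[>] 0] (fun x : ℝ ↦ x ^ r) := by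
  refine ⟨?_, fun r ↦ ?_, fun r ↦ ?_⟩
  · refine hfc.continuousOn_smul isOpen_Ioi.isLocallyClosed (continuousOn_const.mul ?_)
    exact Real.continuousOn_log.mono fun x hx ↦ ne_of_gt hx
  · simp_rw [mul_smul]
    have h := isBigO_rpow_top_log_smul (a := -(r - 1)) (b := -r) (by linarith)
      (by simpa using htop (r - 1))
    simp only [neg_neg] at h
    exact h.const_smul_left c
  · simp_rw [mul_smul]
    have h := isBigO_rpow_zero_log_smul (a := -(r + 1)) (b := -r) (by linarith)
      (by simpa using hbot (r + 1))
    simp only [neg_neg] at h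
    exact h.const_smul_left c

lemma hasDerivAt_mellin_of_forall_isBigO_rpow {f : ℝ → ℂ} (hfc : LocallyIntegrableOn f (Ioi 0))
    (htop : ∀ r : ℝ, f =O[atTop] (fun x : ℝ ↦ x ^ r))
    (hbot : ∀ r : ℝ, f =O[𝓝[>] 0] (fun x : ℝ ↦ x ^ r)) (s : ℂ) :
    HasDerivAt (mellin f) (mellin (fun t ↦ Real.log t • f t) s) s :=
  (mellin_hasDerivAt_of_isBigO_rpow (a := s.re + 1) (b := s.re - 1) hfc (htop _) (by linarith)
    (hbot _) (by linarith)).2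

/-- Iterated derivatives of the Mellin transform of a rapidly decaying function, along an affine
change of variables. -/
lemma iteratedDeriv_mellin_of_forall_isBigO_rpow {f : ℝ → ℂ}
    (hfc : LocallyIntegrableOn f (Ioi 0))
    (htop : ∀ r : ℝ, f =O[atTop] (fun x : ℝ ↦ x ^ r))
    (hbot : ∀ r : ℝ, f =O[𝓝[>] 0] (fun x : ℝ ↦ x ^ r)) (c : ℝ) (d : ℂ) (n : ℕ) :
    iteratedDeriv n (fun s : ℂ ↦ mellin f (c * s + d)) =
      fun s : ℂ ↦ mellin (fun t ↦ (c * Real.log t) ^ n • f t) (c * s + d) := by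
  induction n generalizing f with
  | zero => simp
  | succ n ih =>
    obtain ⟨h1, h2, h3⟩ := isBigO_rpow_log_smul hfc htop hbot c
    have hd : deriv (fun s : ℂ ↦ mellin f (c * s + d)) =
        fun s : ℂ ↦ mellin (fun t ↦ (c * Real.log t) • f t) (c * s + d) := by
      ext s
      have h := (hasDerivAt_mellin_of_forall_isBigO_rpow hfc htop hbot (c * s + d)).comp s
        (((hasDerivAt_id s).const_mul (c : ℂ)).add_const d)
      simp_rw [mul_smul, mellin_const_smul]
      rw [real_smul, mul_comm]
      simpa [Function.comp_def] using h.deriv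
    rw [iteratedDeriv_succ', hd, ih h1 h2 h3]
    simp_rw [smul_smul, ← pow_succ]

lemma mellinConvergent_log_pow_smul {f : ℝ → ℂ} (hfc : LocallyIntegrableOn f (Ioi 0))
    (htop : ∀ r : ℝ, f =O[atTop] (fun x : ℝ ↦ x ^ r))
    (hbot : ∀ r : ℝ, f =O[𝓝[>] 0] (fun x : ℝ ↦ x ^ r)) (c : ℝ) (n : ℕ) (s : ℂ) :
    MellinConvergent (fun t ↦ (c * Real.log t) ^ n • f t) s := by
  induction n generalizing f with
  | zero =>
    simpa using mellinConvergent_of_isBigO_rpow (a := s.re + 1) (b := s.re - 1) hfc (htop _)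
      (by linarith) (hbot _) (by linarith)
  | succ n ih =>
    obtain ⟨h1, h2, h3⟩ := isBigO_rpow_log_smul hfc htop hbot c
    simpa only [smul_smul, ← pow_succ] using ih h1 h2 h3

lemma locallyIntegrableOn_xiKernel : LocallyIntegrableOn (fun t ↦ (xiKernel t : ℂ)) (Ioi 0) :=
  (continuous_ofReal.comp_continuousOn continuousOn_xiKernel).locallyIntegrableOn
    measurableSet_Ioi

lemma isBigO_atTop_ofReal_xiKernel (r : ℝ) :
    (fun t ↦ (xiKernel t : ℂ)) =O[atTop] (fun x : ℝ ↦ x ^ r) :=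
  isBigO_ofReal_left.2 (isBigO_atTop_xiKernel r)

lemma isBigO_zero_ofReal_xiKernel (r : ℝ) :
    (fun t ↦ (xiKernel t : ℂ)) =O[𝓝[>] 0] (fun x : ℝ ↦ x ^ r) :=
  isBigO_ofReal_left.2 (isBigO_zero_xiKernel r)

lemma riemannXi_eq_mellin {s : ℂ} (h0 : s ≠ 0) (h1 : s ≠ 1) :
    riemannXi s = 2 * mellin (fun t ↦ (xiKernel t : ℂ)) (s / 2 + 1 / 2) := by
  have hxi {z : ℂ} (h0 : z ≠ 0) (h1 : z ≠ 1) :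
      riemannXi z = 1 / 2 * z * (z - 1) * completedRiemannZeta₀ z + 1 / 2 := by
    have h1' : 1 - z ≠ 0 := sub_ne_zero.2 h1.symm
    rw [riemannXi, completedRiemannZeta_eq]
    field_simp
    ring
  have hL : Differentiable ℂ fun z : ℂ ↦
      1 / 2 * z * (z - 1) * completedRiemannZeta₀ z + 1 / 2 := by
    have := differentiable_completedZeta₀
    fun_prop
  have hR : Differentiable ℂ fun z : ℂ ↦
      2 * mellin (fun t ↦ (xiKernel t : ℂ)) (z / 2 + 1 / 2) := by
    have : Differentiable ℂ (mellin fun t ↦ (xiKernel t : ℂ)) := fun w ↦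
      (hasDerivAt_mellin_of_forall_isBigO_rpow locallyIntegrableOn_xiKernel
        isBigO_atTop_ofReal_xiKernel isBigO_zero_ofReal_xiKernel w).differentiableAt
    fun_prop
  rw [hxi h0 h1]
  refine congrFun (AnalyticOnNhd.eq_of_eventuallyEq (z₀ := 2)
    (fun z _ ↦ hL.analyticAt z) (fun z _ ↦ hR.analyticAt z) ?_) s
  filter_upwards [(isOpen_lt continuous_const continuous_re).mem_nhds
    (show (1 : ℝ) < (2 : ℂ).re by simp)] with z (hz : 1 < z.re)
  rw [mellin_xiKernel_of_one_lt_re hz, hxi (ne_zero_of_one_lt_re hz)]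
  rintro rfl
  simp at hz

lemma setIntegral_Ioi_zero_eq_two_mul {f : ℝ → ℝ} (hf : IntegrableOn f (Ioi 0))
    (hinv : ∀ x, 1 < x → x ^ (-2 : ℝ) * f x⁻¹ = f x) :
    ∫ x in Ioi 0, f x = 2 * ∫ x in Ioi 1, f x := by
  have hsplit : ∫ x in Ioi 0, f x = (∫ x in Ioo 0 1, f x) + ∫ x in Ioi 1, f x := by
    rw [← integral_Ioc_eq_integral_Ioo, ← setIntegral_union Ioc_disjoint_Ioi_same
      measurableSet_Ioi (hf.mono_set Ioc_subset_Ioi_self)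
      (hf.mono_set (Ioi_subset_Ioi zero_le_one)), Ioc_union_Ioi_eq_Ioi zero_le_one]
  have hcov := integral_comp_rpow_Ioi ((Ioo (0 : ℝ) 1).indicator f) (p := -1) (by simp)
  rw [setIntegral_indicator measurableSet_Ioo, inter_eq_right.2 Ioo_subset_Ioi_self] at hcov
  have : ∫ x in Ioi (0 : ℝ), (|(-1 : ℝ)| * x ^ ((-1 : ℝ) - 1)) •
      (Ioo (0 : ℝ) 1).indicator f (x ^ (-1 : ℝ)) = ∫ x in Ioi (0 : ℝ), (Ioi 1).indicator f x := by
    refine setIntegral_congr_fun measurableSet_Ioi fun x (hx : 0 < x) ↦ ?_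
    simp only [Real.rpow_neg_one]
    by_cases h : 1 < x
    · rw [indicator_of_mem (show x ∈ Ioi 1 from h),
        indicator_of_mem (show x⁻¹ ∈ Ioo 0 1 from ⟨inv_pos.2 hx, inv_lt_one_of_one_lt₀ h⟩),
        ← hinv x h]
      norm_num
    · rw [indicator_of_notMem (show x ∉ Ioi 1 from h),
        indicator_of_notMem (fun h' ↦ h ((inv_lt_one₀ hx).1 h'.2)), smul_zero]
  rw [this, setIntegral_indicator measurableSet_Ioi,
    inter_eq_right.2 (Ioi_subset_Ioi zero_le_one)] at hcov
  rw [hsplit, ← hcov]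
  ring

lemma iteratedDeriv_riemannXi_half (n : ℕ) :
    iteratedDeriv n riemannXi (1 / 2) = 2 * mellin
      (fun t ↦ ((1 / 2 : ℝ) * Real.log t) ^ n • (xiKernel t : ℂ)) (3 / 4) := by
  have h : riemannXi =ᶠ[𝓝 (1 / 2)] fun s ↦
      2 * mellin (fun t ↦ (xiKernel t : ℂ)) ((1 / 2 : ℝ) * s + 1 / 2) := by
    filter_upwards [isOpen_ne.mem_nhds (show (1 / 2 : ℂ) ≠ 0 by norm_num),
      isOpen_ne.mem_nhds (show (1 / 2 : ℂ) ≠ 1 by norm_num)] with s h0 h1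
    rw [riemannXi_eq_mellin h0 h1]
    push_cast
    ring_nf
  rw [h.iteratedDeriv_eq, iteratedDeriv_const_mul_field,
    iteratedDeriv_mellin_of_forall_isBigO_rpow locallyIntegrableOn_xiKernel
      isBigO_atTop_ofReal_xiKernel isBigO_zero_ofReal_xiKernel]
  have e : ((1 / 2 : ℝ) : ℂ) * (1 / 2) + 1 / 2 = 3 / 4 := by push_cast; norm_num
  simp only [e]

theorem a_eq_integral (n : ℕ) :
    a n = 4 * ∫ x in Set.Ioi (1 : ℝ),
      deriv (fun y : ℝ => y ^ ((3 : ℝ) / 2) * deriv psi y) x *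
        (((1 / 2) * Real.log x) ^ (2 * n) / (2 * n).factorial) * x ^ (-(1 : ℝ) / 4) := by
  set f : ℝ → ℝ := fun x ↦
    xiKernel x * ((1 / 2) * Real.log x) ^ (2 * n) * x ^ (-(1 : ℝ) / 4) with hf
  have hcongr : EqOn (fun t : ℝ ↦ (t : ℂ) ^ ((3 / 4 : ℂ) - 1) •
      (((1 / 2 : ℝ) * Real.log t) ^ (2 * n) • (xiKernel t : ℂ))) (fun t ↦ (f t : ℂ)) (Ioi 0) := by
    intro t (ht : 0 < t)
    have : ((3 / 4 : ℂ) - 1) = ((-(1 : ℝ) / 4 : ℝ) : ℂ) := by push_cast; norm_num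
    simp only [hf, this, smul_eq_mul, real_smul, ← ofReal_cpow ht.le, ← ofReal_mul]
    congr 1
    ring
  have hint : IntegrableOn f (Ioi 0) := by
    have h := (integrableOn_congr_fun hcongr measurableSet_Ioi).1 (mellinConvergent_log_pow_smul
      locallyIntegrableOn_xiKernel isBigO_atTop_ofReal_xiKernel isBigO_zero_ofReal_xiKernel
      (1 / 2) (2 * n) (3 / 4))
    exact h.re
  have hinv (x : ℝ) (hx : 1 < x) : x ^ (-2 : ℝ) * f x⁻¹ = f x := by
    have hx0 : 0 < x := zero_lt_one.trans hx
    have e : x ^ (-2 : ℝ) * x ^ (3 / 2 : ℝ) * (x ^ (-(1 : ℝ) / 4))⁻¹ = x ^ (-(1 : ℝ) / 4) := by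
      rw [← Real.rpow_neg hx0.le, ← Real.rpow_add hx0, ← Real.rpow_add hx0]
      norm_num
    simp only [hf]
    rw [xiKernel_inv hx0, Real.log_inv, Real.inv_rpow hx0.le, mul_neg, (even_two_mul n).neg_pow]
    linear_combination (xiKernel x * ((1 / 2) * Real.log x) ^ (2 * n)) * e
  have hderiv : ∫ x in Ioi (1 : ℝ), deriv (fun y : ℝ => y ^ ((3 : ℝ) / 2) * deriv psi y) x *
      (((1 / 2) * Real.log x) ^ (2 * n) / (2 * n).factorial) * x ^ (-(1 : ℝ) / 4) =
      (∫ x in Ioi (1 : ℝ), f x) / (2 * n).factorial := by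
    rw [← integral_div]
    refine setIntegral_congr_fun measurableSet_Ioi fun x (hx : 1 < x) ↦ ?_
    simp only [hf, (hasDerivAt_rpow_mul_deriv_psi (zero_lt_one.trans hx)).deriv]
    ring
  rw [hderiv, a, iteratedDeriv_riemannXi_half, mellin,
    setIntegral_congr_fun measurableSet_Ioi hcongr, integral_complex_ofReal,
    setIntegral_Ioi_zero_eq_two_mul hint hinv, ← ofReal_ofNat, ← ofReal_mul, ofReal_re]
  ring
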